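/- arXiv:1108.4840 — 2 statements merged into one kernel-verified Lean document; each statement's English description precedes it below -/
import Mathlib

section
/- Let p be an odd prime and let a be an integer with p ∤ (16a² − 1). Then ∑_{k=0}^{⌊p/4⌋} C(4k,2k)·a^{2k} ≡ 0 (mod p) if the Legendre symbol (1 − 16a²|p) = −1, and ∑_{k=0}^{⌊p/4⌋} C(4k,2k)·a^{2k} ≡ (1 − 4a|p) (mod p) if (1 − 16a²|p) = 1. -/
/-- Modulo an odd prime `p`, the central binomial coefficients `C(2j, j)` with `j < p` agree with
`C((p - 1) / 2, j) * (-4) ^ j`. -/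
theorem centralBinom_eq_choose_mul_neg_four_pow (p : ℕ) [Fact p.Prime] (hp : p ≠ 2) (j : ℕ)
    (hj : j < p) :
    (Nat.centralBinom j : ZMod p) = (Nat.choose (p / 2) j : ZMod p) * (-4) ^ j := by
  induction j with
  | zero => simp
  | succ j ih =>
    have ih := ih (by omega)
    have hne : ((j + 1 : ℕ) : ZMod p) ≠ 0 := by
      rw [Ne, ZMod.natCast_eq_zero_iff]
      exact Nat.not_dvd_of_pos_of_lt (by omega) hj
    have hodd : p % 2 = 1 := (Nat.Prime.eq_two_or_odd Fact.out).resolve_left hp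
    have hhalf : (2 : ZMod p) * ((p / 2 : ℕ) : ZMod p) + 1 = 0 := by
      have h : ((2 * (p / 2) + 1 : ℕ) : ZMod p) = (p : ZMod p) := by congr 1; omega
      simpa using h
    have hcentral := congrArg (Nat.cast : ℕ → ZMod p) (Nat.succ_mul_centralBinom_succ j)
    have hchoose : (Nat.choose (p / 2) (j + 1) : ZMod p) * ((j + 1 : ℕ) : ZMod p)
        = Nat.choose (p / 2) j * (((p / 2 : ℕ) : ZMod p) - j) := by
      rcases le_or_gt j (p / 2) with h | h
      · have := congrArg (Nat.cast : ℕ → ZMod p) (Nat.choose_succ_right_eq (p / 2) j)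
        rwa [Nat.cast_mul, Nat.cast_mul, Nat.cast_sub h] at this
      · simp [Nat.choose_eq_zero_of_lt h, Nat.choose_eq_zero_of_lt (h.trans j.lt_succ_self)]
    apply mul_left_cancel₀ hne
    push_cast at hcentral hchoose ⊢
    rw [hcentral, ih, pow_succ]
    linear_combination
      (4 * (-4) ^ j) * hchoose + 2 * (Nat.choose (p / 2) j : ZMod p) * (-4) ^ j * hhalf

theorem one_add_pow_eq_sum_range {R : Type*} [CommRing R] (x : R) {n N : ℕ} (h : n < N) :
    (1 + x) ^ n = ∑ j ∈ Finset.range N, (Nat.choose n j : R) * x ^ j := by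
  rw [add_comm, add_pow]
  simp only [one_pow, mul_one]
  simp only [mul_comm (x ^ _)]
  apply Finset.sum_subset (Finset.range_mono h)
  intro j _ hj
  rw [Nat.choose_eq_zero_of_lt (by simpa [Nat.lt_succ_iff] using hj)]
  simp

theorem one_add_pow_add_one_sub_pow {R : Type*} [CommRing R] (x : R) {n m : ℕ}
    (h : n < 2 * m) :
    (1 + x) ^ n + (1 - x) ^ n
      = 2 * ∑ k ∈ Finset.range m, (Nat.choose n (2 * k) : R) * x ^ (2 * k) := by
  have hsplit (f : ℕ → R) : ∑ j ∈ Finset.range (2 * m), f j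
      = ∑ k ∈ Finset.range m, (f (2 * k) + f (2 * k + 1)) := by
    clear h
    induction m with
    | zero => simp
    | succ m ih => rw [Finset.sum_range_succ, ← ih, mul_add, mul_one, Finset.sum_range_succ,
        Finset.sum_range_succ, add_assoc]
  rw [sub_eq_add_neg, one_add_pow_eq_sum_range x h, one_add_pow_eq_sum_range (-x) h,
    ← Finset.sum_add_distrib, hsplit, Finset.mul_sum]
  refine Finset.sum_congr rfl fun k _ => ?_
  rw [pow_succ (-x), (even_two_mul k).neg_pow]
  ring

theorem stmt9 (p : ℕ) [Fact p.Prime] (hp : p ≠ 2) (a : ℤ)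
    (ha : ¬ (p : ℤ) ∣ (16 * a ^ 2 - 1)) :
    (legendreSym p (1 - 16 * a ^ 2) = -1 →
      (∑ k ∈ Finset.range (p / 4 + 1),
          (Nat.choose (4 * k) (2 * k) : ZMod p) * (a : ZMod p) ^ (2 * k)) = 0) ∧
    (legendreSym p (1 - 16 * a ^ 2) = 1 →
      (∑ k ∈ Finset.range (p / 4 + 1),
          (Nat.choose (4 * k) (2 * k) : ZMod p) * (a : ZMod p) ^ (2 * k))
        = (legendreSym p (1 - 4 * a) : ZMod p)) := by
  have hodd : p % 2 = 1 := (Nat.Prime.eq_two_or_odd Fact.out).resolve_left hp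
  have htwo : (2 : ZMod p) ≠ 0 := by
    intro h
    have h : ((2 : ℕ) : ZMod p) = 0 := by exact_mod_cast h
    rw [ZMod.natCast_eq_zero_iff] at h
    exact hp ((Nat.prime_dvd_prime_iff_eq Fact.out Nat.prime_two).mp h)
  have hsum : 2 * (∑ k ∈ Finset.range (p / 4 + 1),
      (Nat.choose (4 * k) (2 * k) : ZMod p) * (a : ZMod p) ^ (2 * k))
      = (legendreSym p (1 + 4 * a) : ZMod p) + (legendreSym p (1 - 4 * a) : ZMod p) := by
    rw [legendreSym.eq_pow, legendreSym.eq_pow]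
    push_cast
    rw [one_add_pow_add_one_sub_pow (m := p / 4 + 1) _ (by omega)]
    congr 1
    refine Finset.sum_congr rfl fun k hk => ?_
    have hk := Finset.mem_range.mp hk
    have hcb := centralBinom_eq_choose_mul_neg_four_pow p hp (2 * k) (by omega)
    rw [Nat.centralBinom, ← mul_assoc, (even_two_mul k).neg_pow] at hcb
    rw [show 4 * k = 2 * 2 * k by ring, hcb, mul_pow, mul_assoc]
  have hmul : legendreSym p (1 - 16 * a ^ 2)
      = legendreSym p (1 + 4 * a) * legendreSym p (1 - 4 * a) := by
    rw [← legendreSym.mul]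
    congr 1
    ring
  rw [hmul]
  constructor <;> intro h <;> apply mul_left_cancel₀ htwo <;> rw [hsum]
  · rcases Int.mul_eq_neg_one_iff_eq_one_or_neg_one.mp h with ⟨h₁, h₂⟩ | ⟨h₁, h₂⟩ <;>
      simp [h₁, h₂]
  · rw [Int.eq_of_mul_eq_one h, two_mul]
end

section
/- Let p > 3 be a prime and let a, b be integers with p ∤ ab. Let ε = (p|3) denote the Legendre symbol of p modulo 3 (so ε = 1 if p ≡ 1 (mod 3) and ε = −1 if p ≡ 2 (mod 3)). Then, with congruences interpreted in ℤ/pℤ: if the Legendre symbol (81b² − 12a|p) = 1, then ∑_{k=0}^{⌊p/3⌋} C(3k,k)·(b^{2k}/a^k) ≡ (−3a)^{⌊p/3⌋+1}·U_{(p−ε)/3 − 1}(9b, 3a) (mod p); and if (81b² − 12a|p) = −1, then ∑_{k=0}^{⌊p/3⌋} C(3k,k)·(b^{2k}/a^k) ≡ −(−3a)^{⌊p/3⌋}·U_{(p−ε)/3 + 1}(9b, 3a) (mod p). -/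
/-- The Lucas sequence `U_n(P,Q)`: `U_0 = 0`, `U_1 = 1`,
`U_{n+1} = P·U_n − Q·U_{n−1}`. -/
def lucasU (P Q : ℤ) : ℕ → ℤ
  | 0 => 0
  | 1 => 1
  | n + 2 => P * lucasU P Q (n + 1) - Q * lucasU P Q n

/-- Addition formula expressing `U_r` through terms shifted by `m`. -/
theorem pow_mul_lucasU (P Q : ℤ) (m r : ℕ) :
    Q ^ m * lucasU P Q r =
      lucasU P Q (r + m) * lucasU P Q (m + 1) - lucasU P Q (r + m + 1) * lucasU P Q m := by
  induction m with
  | zero => simp [lucasU]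
  | succ m ih =>
    have h1 : lucasU P Q (m + 1 + 1) = P * lucasU P Q (m + 1) - Q * lucasU P Q m := rfl
    have h2 : lucasU P Q (r + (m + 1) + 1) =
      P * lucasU P Q (r + m + 1) - Q * lucasU P Q (r + m) := rfl
    rw [h1, h2, ← add_assoc, pow_succ]
    linear_combination Q * ih

theorem QuadraticAlgebra.omega_pow_succ_eq_lucasU {R : Type*} [CommRing R] (P Q : ℤ) (k : ℕ) :
    (⟨0, 1⟩ : QuadraticAlgebra R (-(Q : R)) (P : R)) ^ (k + 1) =
      ⟨-(Q * lucasU P Q k : R), (lucasU P Q (k + 1) : R)⟩ := by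
  induction k with
  | zero => ext <;> simp [lucasU]
  | succ k ih =>
    have h1 : lucasU P Q (k + 1 + 1) = P * lucasU P Q (k + 1) - Q * lucasU P Q k := rfl
    rw [pow_succ, ih, h1]
    ext
    · simp
    · simp
      ring

theorem lucasU_prime_of_discrim_pow (p : ℕ) [Fact p.Prime] (hp : p ≠ 2) (P Q : ℤ) :
    (lucasU P Q p : ZMod p) = ((P ^ 2 - 4 * Q : ℤ) : ZMod p) ^ (p / 2) ∧
      2 * ((Q : ZMod p) * lucasU P Q (p - 1)) =
        (((P ^ 2 - 4 * Q : ℤ) : ZMod p) ^ (p / 2) - 1) * P := by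
  have hpp : p.Prime := Fact.out
  have hodd : 2 * (p / 2) + 1 = p := by
    have := hpp.eq_two_or_odd
    omega
  have h2 : (2 : ZMod p) ≠ 0 := by
    intro h
    have h' : ((2 : ℕ) : ZMod p) = 0 := by exact_mod_cast h
    rw [ZMod.natCast_eq_zero_iff] at h'
    have := Nat.le_of_dvd (by norm_num) h'
    have := hpp.two_le
    omega
  have : CharP (QuadraticAlgebra (ZMod p) (-(Q : ZMod p)) (P : ZMod p)) p :=
    charP_of_injective_algebraMap (R := ZMod p) QuadraticAlgebra.algebraMap_injective p
  obtain ⟨f, hf⟩ : ∃ f : ZMod p →+* QuadraticAlgebra (ZMod p) (-(Q : ZMod p)) (P : ZMod p),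
      ∀ r, f r = ⟨r, 0⟩ :=
    ⟨algebraMap _ _, fun r => by ext <;> simp⟩
  have hw := QuadraticAlgebra.omega_pow_succ_eq_lucasU (R := ZMod p) P Q (p - 1)
  rw [Nat.sub_add_cancel hpp.one_le] at hw
  generalize hD : ((P ^ 2 - 4 * Q : ℤ) : ZMod p) = D
  have hsq : (f 2 * ⟨0, 1⟩ - f P) ^ 2 = f D := by
    rw [← hD]
    ext <;> simp [hf, pow_two] <;> ring
  have hfrob : (f 2 * ⟨0, 1⟩ - f P) ^ p = f 2 * ⟨0, 1⟩ ^ p - f P := by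
    rw [sub_pow_char, mul_pow, ← map_pow, ← map_pow, ZMod.pow_card, ZMod.pow_card]
  have hpow : (f 2 * ⟨0, 1⟩ - f P) ^ p = f (D ^ (p / 2)) * (f 2 * ⟨0, 1⟩ - f P) := by
    rw [map_pow, ← hsq, ← pow_mul, ← pow_succ, hodd]
  rw [hfrob, hw] at hpow
  have hre := congrArg QuadraticAlgebra.re hpow
  have him := congrArg QuadraticAlgebra.im hpow
  simp only [hf, QuadraticAlgebra.re_sub, QuadraticAlgebra.im_sub, QuadraticAlgebra.re_mul,
    QuadraticAlgebra.im_mul] at hre him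
  constructor
  · apply mul_left_cancel₀ h2
    linear_combination him
  · linear_combination -hre

/-- Even and odd terms of a Lucas sequence as Morgan-Voyce polynomials. -/
theorem lucasU_eq_sum_choose {R : Type*} [CommRing R] (P Q : ℤ) (y : R)
    (hy : (P : R) ^ 2 = -Q * y) (n : ℕ) :
    (lucasU P Q (2 * n + 1) : R) =
        (-Q) ^ n * ∑ k ∈ Finset.range (n + 1), (Nat.choose (n + k) (2 * k) : R) * y ^ k ∧
      (lucasU P Q (2 * n + 2) : R) =
        P * (-Q) ^ n *
          ∑ k ∈ Finset.range (n + 1), (Nat.choose (n + k + 1) (2 * k + 1) : R) * y ^ k := by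
  induction n with
  | zero => simp [lucasU]
  | succ n ih =>
    obtain ⟨ih1, ih2⟩ := ih
    have hodd : ∑ k ∈ Finset.range (n + 1 + 1), (Nat.choose (n + 1 + k) (2 * k) : R) * y ^ k =
        y * ∑ k ∈ Finset.range (n + 1), (Nat.choose (n + k + 1) (2 * k + 1) : R) * y ^ k +
          ∑ k ∈ Finset.range (n + 1), (Nat.choose (n + k) (2 * k) : R) * y ^ k := by
      have hext : ∑ k ∈ Finset.range (n + 1), (Nat.choose (n + k) (2 * k) : R) * y ^ k =
          ∑ k ∈ Finset.range (n + 1 + 1), (Nat.choose (n + k) (2 * k) : R) * y ^ k := by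
        rw [Finset.sum_range_succ _ (n + 1), Nat.choose_eq_zero_of_lt (by omega)]
        simp
      rw [hext, Finset.sum_range_succ' _ (n + 1), Finset.sum_range_succ' _ (n + 1),
        Finset.mul_sum, ← add_assoc, ← Finset.sum_add_distrib]
      congr 1
      · refine Finset.sum_congr rfl fun k _ => ?_
        have : Nat.choose (n + 1 + (k + 1)) (2 * (k + 1)) =
            Nat.choose (n + k + 1) (2 * k + 1) + Nat.choose (n + (k + 1)) (2 * (k + 1)) := by
          rw [show n + 1 + (k + 1) = (n + k + 1) + 1 by ring,
            show 2 * (k + 1) = (2 * k + 1) + 1 by ring, Nat.choose_succ_succ]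
          rfl
        rw [this]
        push_cast
        ring
      · simp
    have heven :
        ∑ k ∈ Finset.range (n + 1 + 1), (Nat.choose (n + 1 + k + 1) (2 * k + 1) : R) * y ^ k =
        ∑ k ∈ Finset.range (n + 1 + 1), (Nat.choose (n + 1 + k) (2 * k) : R) * y ^ k +
          ∑ k ∈ Finset.range (n + 1), (Nat.choose (n + k + 1) (2 * k + 1) : R) * y ^ k := by
      have hext :
          ∑ k ∈ Finset.range (n + 1), (Nat.choose (n + k + 1) (2 * k + 1) : R) * y ^ k =
          ∑ k ∈ Finset.range (n + 1 + 1), (Nat.choose (n + k + 1) (2 * k + 1) : R) * y ^ k := by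
        rw [Finset.sum_range_succ _ (n + 1), Nat.choose_eq_zero_of_lt (by omega)]
        simp
      rw [hext, ← Finset.sum_add_distrib]
      refine Finset.sum_congr rfl fun k _ => ?_
      rw [Nat.choose_succ_succ, show n + k + 1 = n + 1 + k by ring]
      push_cast
      ring
    have h1 : lucasU P Q (2 * (n + 1) + 1) =
      P * lucasU P Q (2 * n + 2) - Q * lucasU P Q (2 * n + 1) := rfl
    have h2 : lucasU P Q (2 * (n + 1) + 2) =
      P * lucasU P Q (2 * (n + 1) + 1) - Q * lucasU P Q (2 * n + 2) := rfl
    have hU : (lucasU P Q (2 * (n + 1) + 1) : R) = (-Q) ^ (n + 1) *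
        ∑ k ∈ Finset.range (n + 1 + 1), (Nat.choose (n + 1 + k) (2 * k) : R) * y ^ k := by
      rw [h1, hodd]
      push_cast
      rw [ih1, ih2]
      linear_combination ((-Q : R) ^ n *
        ∑ k ∈ Finset.range (n + 1), (Nat.choose (n + k + 1) (2 * k + 1) : R) * y ^ k) * hy
    refine ⟨hU, ?_⟩
    rw [heven, h2]
    push_cast
    rw [hU, ih2]
    ring

theorem choose_three_mul_succ (k : ℕ) :
    (2 * k + 1) * (2 * k + 2) * Nat.choose (3 * (k + 1)) (k + 1) =
      3 * (3 * k + 1) * (3 * k + 2) * Nat.choose (3 * k) k := by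
  have h1 := Nat.add_choose_mul_factorial_mul_factorial (2 * k) k
  have h2 := Nat.add_choose_mul_factorial_mul_factorial (2 * (k + 1)) (k + 1)
  rw [show 2 * k + k = 3 * k by ring] at h1
  rw [show 2 * (k + 1) + (k + 1) = 3 * (k + 1) by ring] at h2
  rw [show 3 * (k + 1) = 3 * k + 1 + 1 + 1 by ring, show 2 * (k + 1) = 2 * k + 1 + 1 by ring] at *
  simp only [Nat.factorial_succ] at h2
  rw [← h1] at h2
  have hpos : 0 < (k + 1) * ((2 * k).factorial * k.factorial) := by positivity
  apply Nat.eq_of_mul_eq_mul_right hpos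
  linear_combination h2

theorem choose_add_two_mul_succ {n k : ℕ} (hk : k ≤ n) :
    (2 * k + 1) * (2 * k + 2) * Nat.choose (n + (k + 1)) (2 * (k + 1)) =
      (n + k + 1) * (n - k) * Nat.choose (n + k) (2 * k) := by
  have h1 := Nat.add_one_mul_choose_eq (n + k) (2 * k + 1)
  have h2 := Nat.choose_succ_right_eq (n + k) (2 * k)
  rw [show n + k - 2 * k = n - k by omega] at h2
  rw [show n + (k + 1) = n + k + 1 by ring, show 2 * (k + 1) = 2 * k + 1 + 1 by ring]
  linear_combination (2 * k + 1) * h1.symm + (n + k + 1) * h2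

theorem choose_three_mul_eq_zmod (p : ℕ) [Fact p.Prime] (hp : 3 < p) {k : ℕ} (hk : k ≤ p / 3) :
    (Nat.choose (3 * k) k : ZMod p) = Nat.choose (p / 3 + k) (2 * k) * (-27) ^ k := by
  have hpp : p.Prime := Fact.out
  induction k with
  | zero => simp
  | succ k ih =>
    have ih := ih (by omega)
    have h1 := congrArg (Nat.cast (R := ZMod p)) (choose_three_mul_succ k)
    have h2 := congrArg (Nat.cast (R := ZMod p))
      (choose_add_two_mul_succ (n := p / 3) (k := k) (by omega))
    have hne : ∀ j : ℕ, 0 < j → j < p → (j : ZMod p) ≠ 0 := fun j hj hjp h =>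
      absurd (Nat.le_of_dvd hj ((ZMod.natCast_eq_zero_iff _ _).1 h)) (by omega)
    have hc1 := hne (2 * k + 1) (by omega) (by omega)
    have hc2 := hne (2 * k + 2) (by omega) (by omega)
    have hn : (3 * ((p / 3 : ℕ) : ZMod p) + 1) * (3 * ((p / 3 : ℕ) : ZMod p) + 2) = 0 := by
      have h3 : ¬ p % 3 = 0 := fun h => by
        have := (Nat.prime_dvd_prime_iff_eq Nat.prime_three hpp).1 (Nat.dvd_of_mod_eq_zero h)
        omega
      have h0 : p = 3 * (p / 3) + 1 ∨ p = 3 * (p / 3) + 2 := by omega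
      rcases h0 with h | h
      · have := congrArg (Nat.cast (R := ZMod p)) h
        push_cast at this
        rw [← this]
        simp
      · have := congrArg (Nat.cast (R := ZMod p)) h
        push_cast at this
        rw [← this]
        simp
    apply mul_left_cancel₀ (mul_ne_zero hc1 hc2)
    push_cast [Nat.cast_sub (show k ≤ p / 3 by omega)] at h1 h2 ⊢
    rw [h1, ih, pow_succ]
    linear_combination (27 * (-27) ^ k : ZMod p) * h2 + 3 *
      (Nat.choose (p / 3 + k) (2 * k) * (-27) ^ k) * hn

theorem sub_legendreSym_three_div_three (p : ℕ) (hp3 : p % 3 ≠ 0) :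
    (p : ℤ) - legendreSym 3 p = 3 * (p - (2 * (p / 3 : ℕ) + 1)) := by
  have h0 : p % 3 = 1 ∨ p % 3 = 2 := by omega
  rw [legendreSym.mod]
  rcases h0 with h | h
  · rw [show (p : ℤ) % (3 : ℕ) = 1 by omega, show legendreSym 3 1 = 1 by decide]
    omega
  · rw [show (p : ℤ) % (3 : ℕ) = 2 by omega, show legendreSym 3 2 = -1 by decide]
    omega

theorem stmt14 (p : ℕ) [Fact p.Prime] (hp : 3 < p) (a b : ℤ)
    (hab : ¬ (p : ℤ) ∣ a * b) :
    (legendreSym p (81 * b ^ 2 - 12 * a) = 1 →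
      (∑ k ∈ Finset.range (p / 3 + 1),
          (Nat.choose (3 * k) k : ZMod p) * (b : ZMod p) ^ (2 * k) / (a : ZMod p) ^ k)
        = (-3 * (a : ZMod p)) ^ (p / 3 + 1) *
            (lucasU (9 * b) (3 * a)
              ((((p : ℤ) - legendreSym 3 p) / 3 - 1).toNat) : ZMod p)) ∧
    (legendreSym p (81 * b ^ 2 - 12 * a) = -1 →
      (∑ k ∈ Finset.range (p / 3 + 1),
          (Nat.choose (3 * k) k : ZMod p) * (b : ZMod p) ^ (2 * k) / (a : ZMod p) ^ k)
        = -((-3 * (a : ZMod p)) ^ (p / 3)) *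
            (lucasU (9 * b) (3 * a)
              ((((p : ℤ) - legendreSym 3 p) / 3 + 1).toNat) : ZMod p)) := by
  have hpp : p.Prime := Fact.out
  have hp3 : p % 3 ≠ 0 := fun h => by
    have := (Nat.prime_dvd_prime_iff_eq Nat.prime_three hpp).1 (Nat.dvd_of_mod_eq_zero h)
    omega
  have hp2 : p % 2 = 1 := hpp.eq_two_or_odd.resolve_left (by omega)
  obtain ⟨m, hm⟩ : ∃ m, 2 * (p / 3) + 1 + m = p := ⟨p - (2 * (p / 3) + 1), by omega⟩
  have hdiv : ((p : ℤ) - legendreSym 3 p) / 3 = m := by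
    rw [sub_legendreSym_three_div_three p hp3]
    omega
  have hmeven : Even m := Nat.even_iff.2 (by omega)
  have hm1 : 1 ≤ m := by omega
  have ha : (a : ZMod p) ≠ 0 := fun h =>
    hab (((ZMod.intCast_zmod_eq_zero_iff_dvd _ _).1 h).mul_right b)
  have h3 : (3 : ZMod p) ≠ 0 := fun h => by
    have h' : ((3 : ℕ) : ZMod p) = 0 := by exact_mod_cast h
    have := Nat.le_of_dvd (by norm_num) ((ZMod.natCast_eq_zero_iff _ _).1 h')
    omega
  have h2 : (2 : ZMod p) ≠ 0 := fun h => by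
    have h' : ((2 : ℕ) : ZMod p) = 0 := by exact_mod_cast h
    have := Nat.le_of_dvd (by norm_num) ((ZMod.natCast_eq_zero_iff _ _).1 h')
    omega
  have hQ : (-3 * (a : ZMod p)) ≠ 0 := mul_ne_zero (neg_ne_zero.2 h3) ha
  have hfermat : (-3 * (a : ZMod p)) ^ (p / 3) * (-3 * (a : ZMod p)) ^ (p / 3) *
      (-3 * (a : ZMod p)) ^ m = 1 := by
    rw [← pow_add, ← pow_add, show p / 3 + p / 3 + m = p - 1 by omega]
    exact ZMod.pow_card_sub_one_eq_one hQ
  have hS := (lucasU_eq_sum_choose (R := ZMod p) (9 * b) (3 * a) (-27 * (b ^ 2 / a))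
    (by push_cast; field_simp; ring) (p / 3)).1
  have hsum : ∑ k ∈ Finset.range (p / 3 + 1),
      (Nat.choose (p / 3 + k) (2 * k) : ZMod p) * (-27 * ((b : ZMod p) ^ 2 / a)) ^ k =
      ∑ k ∈ Finset.range (p / 3 + 1),
        (Nat.choose (3 * k) k : ZMod p) * (b : ZMod p) ^ (2 * k) / (a : ZMod p) ^ k := by
    refine Finset.sum_congr rfl fun k hk => ?_
    rw [choose_three_mul_eq_zmod p hp (by simpa [Nat.lt_succ_iff] using hk), mul_pow, div_pow,
      ← pow_mul]
    ring
  rw [hsum] at hS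
  set S := ∑ k ∈ Finset.range (p / 3 + 1),
    (Nat.choose (3 * k) k : ZMod p) * (b : ZMod p) ^ (2 * k) / (a : ZMod p) ^ k
  have hadd := congrArg (Int.cast (R := ZMod p))
    (pow_mul_lucasU (9 * b) (3 * a) m (2 * (p / 3) + 1))
  rw [hm] at hadd
  obtain ⟨hUp, hUp1⟩ := lucasU_prime_of_discrim_pow p (by omega) (9 * b) (3 * a)
  have hdisc : (((9 * b) ^ 2 - 4 * (3 * a) : ℤ) : ZMod p) ^ (p / 2) =
      legendreSym p (81 * b ^ 2 - 12 * a) := by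
    rw [legendreSym.eq_pow]
    congr 2
    ring
  rw [hdisc] at hUp hUp1
  have hrec : ∀ j, 1 ≤ j → lucasU (9 * b) (3 * a) (j + 1) =
      9 * b * lucasU (9 * b) (3 * a) j - 3 * a * lucasU (9 * b) (3 * a) (j - 1) := by
    intro j hj
    obtain ⟨i, rfl⟩ := Nat.exists_eq_add_of_le' hj
    rfl
  rw [hrec p (by omega)] at hadd
  push_cast at hadd hS hUp1
  rw [hS, ← hmeven.neg_pow] at hadd
  rw [hdiv]
  rw [show -(3 * (a : ZMod p)) = -3 * a by ring] at hadd
  constructor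
  · intro hl
    rw [hl] at hUp hUp1
    push_cast at hUp hUp1
    have hz : 3 * (a : ZMod p) * lucasU (9 * b) (3 * a) (p - 1) = 0 :=
      mul_left_cancel₀ h2 (by rw [hUp1]; ring)
    rw [show ((m : ℤ) - 1).toNat = m - 1 by omega]
    rw [hz, hUp, hrec m hm1] at hadd
    push_cast at hadd
    rw [pow_succ]
    linear_combination (-3 * (a : ZMod p)) ^ (p / 3) * hadd - S * hfermat
  · intro hl
    rw [hl] at hUp hUp1
    push_cast at hUp hUp1
    have hz : 3 * (a : ZMod p) * lucasU (9 * b) (3 * a) (p - 1) = -(9 * b) :=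
      mul_left_cancel₀ h2 (by rw [hUp1]; ring)
    rw [show ((m : ℤ) + 1).toNat = m + 1 by omega]
    rw [hz, hUp] at hadd
    linear_combination (-3 * (a : ZMod p)) ^ (p / 3) * hadd - S * hfermat
end
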